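/- Define F(u,c) = -1 - √(2u) - c·u. Let u > 0 and let w be a real number with w ≤ -1 satisfying w·e^w = -e^{-u-1}. Then for every real c ≥ 1 one has F(u,c) < w, and for every real c ≤ 2/3 one has w < F(u,c). -/

import Mathlib

theorem lam_aux_log (s : ℝ) (hs : 0 < s) :
    s - s ^ 2 / 6 < Real.log (1 + s + s ^ 2 / 3) := by
  have hd : ∀ x : ℝ, 0 ≤ x →
      HasDerivAt (fun x : ℝ => Real.log (1 + x + x ^ 2 / 3) - (x - x ^ 2 / 6))
        ((0 + 1 + (2 : ℕ) * x ^ (2 - 1) * 1 / 3) / (1 + x + x ^ 2 / 3)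
          - (1 - (2 : ℕ) * x ^ (2 - 1) * 1 / 6)) x := by
    intro x hx
    have hi := hasDerivAt_id x
    have h1 : HasDerivAt (fun x : ℝ => 1 + x + x ^ 2 / 3)
        (0 + 1 + (2 : ℕ) * x ^ (2 - 1) * 1 / 3) x :=
      ((hasDerivAt_const x (1 : ℝ)).add hi).add ((hi.pow 2).div_const 3)
    have h2 : HasDerivAt (fun x : ℝ => x - x ^ 2 / 6)
        (1 - (2 : ℕ) * x ^ (2 - 1) * 1 / 6) x := hi.sub ((hi.pow 2).div_const 6)
    exact (h1.log (by positivity)).sub h2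
  have hm : StrictMonoOn (fun x : ℝ => Real.log (1 + x + x ^ 2 / 3) - (x - x ^ 2 / 6))
      (Set.Ici 0) := by
    apply strictMonoOn_of_deriv_pos (convex_Ici 0)
    · intro x hx
      exact (hd x hx).continuousAt.continuousWithinAt
    · intro x hx
      rw [interior_Ici] at hx
      have hx' : 0 < x := hx
      rw [(hd x hx'.le).deriv]
      have hp : 0 < 1 + x + x ^ 2 / 3 := by positivity
      have : (0 + 1 + (2 : ℕ) * x ^ (2 - 1) * 1 / 3) / (1 + x + x ^ 2 / 3)
          - (1 - (2 : ℕ) * x ^ (2 - 1) * 1 / 6) = (x ^ 3 / 9) / (1 + x + x ^ 2 / 3) := by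
        rw [eq_div_iff hp.ne', sub_mul, div_mul_cancel₀ _ hp.ne']
        push_cast
        ring
      rw [this]
      positivity
  have := hm (Set.self_mem_Ici) (Set.mem_Ici.2 hs.le) hs
  norm_num at this
  linarith

theorem lambert_Wm1_bounds_family (u w : ℝ) (hu : 0 < u) (hw : w ≤ -1)
    (hWw : w * Real.exp w = -Real.exp (-u - 1)) :
    (∀ c : ℝ, 1 ≤ c → -1 - Real.sqrt (2 * u) - c * u < w) ∧
    (∀ c : ℝ, c ≤ 2 / 3 → w < -1 - Real.sqrt (2 * u) - c * u) := by
  have hwpos : 0 < -w := by linarith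
  have hlog : Real.log (-w) + w = -u - 1 := by
    have h : (-w) * Real.exp w = Real.exp (-u - 1) := by linarith
    have h2 := congrArg Real.log h
    rwa [Real.log_mul hwpos.ne' (Real.exp_pos _).ne', Real.log_exp, Real.log_exp] at h2
  obtain ⟨s, hsdef⟩ : ∃ s, s = Real.sqrt (2 * u) := ⟨_, rfl⟩
  have hs : 0 < s := by rw [hsdef]; exact Real.sqrt_pos.2 (by linarith)
  have hs2 : s ^ 2 = 2 * u := by rw [hsdef]; exact Real.sq_sqrt (by linarith)
  rw [← hsdef]
  constructor
  · intro c hc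
    have hcu : u ≤ c * u := by nlinarith
    obtain ⟨y, hy⟩ : ∃ y, y = Real.log (-w) := ⟨_, rfl⟩
    have hey : Real.exp y = -w := by rw [hy, Real.exp_log hwpos]
    rw [← hy] at hlog
    have hylt : y < s := by
      by_contra hcon
      push Not at hcon
      have hy0 : 0 < y := by linarith
      have h3 := Real.sum_le_exp_of_nonneg hy0.le 4
      norm_num [Finset.sum_range_succ, Nat.factorial] at h3
      have : 0 < y ^ 3 := by positivity
      nlinarith
    linarith
  · intro c hc
    have hcu : c * u ≤ 2 / 3 * u := by nlinarith
    by_contra hcon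
    push Not at hcon
    have h1 := lam_aux_log s hs
    have hT : -w ≤ 1 + s + s ^ 2 / 3 := by linarith
    have hTp : 0 < 1 + s + s ^ 2 / 3 := by positivity
    have h2 := Real.log_le_sub_one_of_pos (div_pos hTp hwpos)
    rw [Real.log_div hTp.ne' hwpos.ne'] at h2
    have h3 : (1 + s + s ^ 2 / 3) / (-w) - 1 ≤ (1 + s + s ^ 2 / 3) - (-w) := by
      rw [sub_le_iff_le_add, div_le_iff₀ hwpos]
      nlinarith
    linarith
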